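/- If c : V → Fin n is a proper n-coloring of Γ, then p(c) : V → Fin (n−1) is a proper (n−1)-coloring of Γ. -/

import Mathlib

open MeasureTheory

/-- The recoloring map `p : (V → Fin n) → (V → Fin (n-1))`: labels with value `< n-1`
are unchanged; a vertex labeled `n-1` is relabeled with the least element of
`Fin (n-1)` not occurring among the labels of its neighbors (taking the junk value
`0` if no such element exists, which does not happen when the vertex has at most
`n-2` neighbors). -/
noncomputable def recolor {V : Type} (Γ : SimpleGraph V) {n : ℕ} (hn : 2 ≤ n)
    (c : V → Fin n) (v : V) : Fin (n - 1) :=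
  if h : (c v : ℕ) < n - 1 then ⟨c v, h⟩
  else
    ⟨sInf {m : ℕ | m < n - 1 ∧ ∀ w ∈ Γ.neighborSet v, (c w : ℕ) ≠ m}, by
      rcases Set.eq_empty_or_nonempty
          {m : ℕ | m < n - 1 ∧ ∀ w ∈ Γ.neighborSet v, (c w : ℕ) ≠ m} with he | hne
      · rw [he, Nat.sInf_empty]; omega
      · exact (Nat.sInf_mem hne).1⟩

/-- If every vertex of `Γ` has degree at most `k`, `n ≥ k+2`, and
`c : V → Fin n` is a proper `n`-coloring of `Γ`, then `p c : V → Fin (n-1)` is a proper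
`(n-1)`-coloring of `Γ`. -/
theorem recolor_proper {V : Type} (Γ : SimpleGraph V) (k n : ℕ) (hn : k + 2 ≤ n)
    (hdeg : ∀ v : V, (Γ.neighborSet v).Finite ∧ (Γ.neighborSet v).ncard ≤ k)
    (c : V → Fin n) (hc : ∀ u v : V, Γ.Adj u v → c u ≠ c v) :
    ∀ u v : V, Γ.Adj u v → recolor Γ (by omega : 2 ≤ n) c u ≠ recolor Γ (by omega) c v := by
  have key : ∀ v : V, sInf {m : ℕ | m < n - 1 ∧ ∀ w ∈ Γ.neighborSet v, (c w : ℕ) ≠ m} ∈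
      {m : ℕ | m < n - 1 ∧ ∀ w ∈ Γ.neighborSet v, (c w : ℕ) ≠ m} := by
    intro v
    apply Nat.sInf_mem
    by_contra hne
    rw [Set.not_nonempty_iff_eq_empty] at hne
    obtain ⟨hfin, hcard⟩ := hdeg v
    have hsub : Set.Iio (n - 1) ⊆ (fun w => (c w : ℕ)) '' Γ.neighborSet v := by
      intro m hm
      by_contra hcon
      have : m ∈ {m : ℕ | m < n - 1 ∧ ∀ w ∈ Γ.neighborSet v, (c w : ℕ) ≠ m} :=
        ⟨hm, fun w hw h => hcon ⟨w, hw, h⟩⟩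
      rw [hne] at this
      exact this
    have h1 := Set.ncard_le_ncard hsub (hfin.image _)
    have h2 := Set.ncard_image_le (f := fun w => (c w : ℕ)) hfin
    have h3 : (Set.Iio (n - 1)).ncard = n - 1 := by
      rw [← Finset.coe_Iio, Set.ncard_coe_finset, Nat.card_Iio]
    omega
  intro u v huv heq
  have hne : (c u : ℕ) ≠ c v := fun h => hc u v huv (Fin.ext h)
  have heq' := congrArg Fin.val heq
  have hu := (c u).isLt
  have hv := (c v).isLt
  unfold recolor at heq'
  split_ifs at heq' with h1 h2 h2
  · exact hne heq'
  · exact (key v).2 u huv.symm heq'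
  · exact (key u).2 v huv heq'.symm
  · omega
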